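/- arXiv:2408.02425 — 7 statements merged into one kernel-verified Lean document; each statement's English description precedes it below -/
import Mathlib

section
/- Let S be an additively closed subset of ℕ such that S* = S \ {0} is nonempty, let m = min S*, and let H be the set consisting of, for each residue class i modulo m such that S* contains an element congruent to i modulo m, the least element of S* congruent to i modulo m. Then H is a finite set and S ∪ {0} equals the additive submonoid of ℕ generated by H. -/
/-- Let `S` be an additively closed subset of `ℕ` with `S \ {0}` nonempty and
`m = min (S \ {0})`. Let `H` be the set of least elements of `S \ {0}` in each residue
class modulo `m` that meets `S \ {0}`.  Then `H` is finite and `S ∪ {0}` is the additive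
submonoid of `ℕ` generated by `H`. -/
theorem standard_basis_finite_and_generates
    (S : Set ℕ) (hadd : ∀ a ∈ S, ∀ b ∈ S, a + b ∈ S)
    (hne : (S \ {0}).Nonempty) (m : ℕ) (hm : m = sInf (S \ {0}))
    (H : Set ℕ)
    (hH : H = {h : ℕ | h ∈ S ∧ h ≠ 0 ∧ ∀ s ∈ S, s ≠ 0 → s % m = h % m → h ≤ s}) :
    H.Finite ∧ insert 0 S = (AddSubmonoid.closure H : Set ℕ) := by
  subst hH
  obtain ⟨hmS, hm0⟩ : m ∈ S \ {0} := hm ▸ Nat.sInf_mem hne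
  have hm0 : m ≠ 0 := hm0
  have hmin : ∀ s ∈ S, s ≠ 0 → m ≤ s := fun s hs hs0 => hm ▸ Nat.sInf_le ⟨hs, hs0⟩
  refine ⟨?_, Set.Subset.antisymm ?_ ?_⟩
  · refine Set.Finite.of_injOn (f := (· % m)) (t := Set.Iio m)
      (fun h _ => Nat.mod_lt h (Nat.pos_of_ne_zero hm0)) ?_ (Set.finite_Iio m)
    rintro a ⟨haS, ha0, ha⟩ b ⟨hbS, hb0, hb⟩ hab
    exact le_antisymm (ha b hbS hb0 hab.symm) (hb a haS ha0 hab)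
  · intro s hs
    by_cases hs0 : s = 0
    · rw [hs0]
      exact zero_mem (AddSubmonoid.closure _)
    replace hs : s ∈ S := hs.resolve_left hs0
    classical
    have hex : ∃ t, t ∈ S ∧ t ≠ 0 ∧ t % m = s % m := ⟨s, hs, hs0, rfl⟩
    obtain ⟨hS, h0, hmod⟩ := Nat.find_spec hex
    have hle : Nat.find hex ≤ s := Nat.find_min' hex ⟨hs, hs0, rfl⟩
    obtain ⟨k, hk⟩ := (Nat.modEq_iff_dvd' hle).mp hmod
    rw [show s = Nat.find hex + k • m by rw [smul_eq_mul, mul_comm]; omega]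
    refine add_mem (AddSubmonoid.subset_closure ?_)
      (nsmul_mem (AddSubmonoid.subset_closure ?_) k)
    · exact ⟨hS, h0, fun t ht ht0 htm => Nat.find_min' hex ⟨ht, ht0, htm.trans hmod⟩⟩
    · exact ⟨hmS, hm0, fun t ht ht0 _ => hmin t ht ht0⟩
  · intro x hx
    induction hx using AddSubmonoid.closure_induction with
    | mem x hx => exact Or.inr hx.1
    | zero => exact Or.inl rfl
    | add x y _ _ hx hy =>
      rcases hx with rfl | hx
      · rwa [zero_add]
      rcases hy with rfl | hy
      · exact Or.inr hx
      · exact Or.inr (hadd x hx y hy)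
end

section
/- Let S be an additively closed subset of ℕ with 0 ∈ S and S* = S \ {0} nonempty, and let m = min S*. If x ∈ PF(S), then x + m ∈ S* and x + m is the least element of S* congruent to x + m modulo m; that is, x + m belongs to the standard basis of S, so PF(S) ⊆ H − m where H is the standard basis of S. -/
/-- Let `S` be an additively closed subset of `ℕ` with `0 ∈ S`, `S \ {0}`
nonempty and `m = min (S \ {0})`.  If `x ∈ PF(S)`, then `x + m ∈ S \ {0}` and `x + m` is
the least element of `S \ {0}` in its residue class modulo `m`; i.e. `x + m` belongs to
the standard basis of `S`, so `PF(S) ⊆ H - m` for the standard basis `H`. -/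
theorem pf_subset_standard_basis_sub_m
    (S : Set ℕ) (hadd : ∀ a ∈ S, ∀ b ∈ S, a + b ∈ S) (h0 : 0 ∈ S)
    (hne : (S \ {0}).Nonempty) (m : ℕ) (hm : m = sInf (S \ {0}))
    (PF : Set ℕ)
    (hPF : PF = {x : ℕ | x ∉ S ∧ ∀ s ∈ S \ {0}, x + s ∈ S})
    (x : ℕ) (hx : x ∈ PF) :
    x + m ∈ S \ {0} ∧ ∀ s ∈ S \ {0}, s % m = (x + m) % m → x + m ≤ s := by
  subst hPF
  obtain ⟨hxS, hxs⟩ := hx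
  have hmem : m ∈ S \ {0} := hm ▸ Nat.sInf_mem hne
  have hm0 : m ≠ 0 := hmem.2
  have hmul : ∀ k : ℕ, m * k ∈ S := by
    intro k
    induction k with
    | zero => simpa using h0
    | succ k ih => exact hadd _ ih _ hmem.1
  refine ⟨⟨hxs m hmem, fun h => hm0 (Nat.add_eq_zero_iff.mp h).2⟩, ?_⟩
  intro s hs hmod
  by_contra! hlt
  rw [Nat.add_mod_right] at hmod
  have hle : s ≤ x := by
    by_contra! hxs_lt
    have hdvd : m ∣ s - x := (Nat.modEq_iff_dvd' hxs_lt.le).mp hmod.symm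
    have := Nat.le_of_dvd (by omega) hdvd
    omega
  obtain ⟨k, hk⟩ := (Nat.modEq_iff_dvd' hle).mp hmod
  have hx_eq : x = s + m * k := by omega
  exact hxS (hx_eq ▸ hadd s hs.1 _ (hmul k))
end

section
/- Let G be a proper subset of ℕ, let A = ℕ \ G, assume A \ {0} is nonempty, let m = min(A \ {0}), and for each i with 0 ≤ i < m let h_i ∈ ℕ ∪ {∞} be the infimum of {a ∈ A : a > 0 and a ≡ i (mod m)} (equal to ∞ when this set is empty). Then A is closed under addition if and only if the following two conditions hold: (1) for every x ∈ G and every a ∈ A with a > 0 and a ≡ x (mod m), one has x < a; and (2) for all i, j with 0 ≤ i, j < m, h_{(i+j) mod m} ≤ h_i + h_j in ℕ ∪ {∞} (in particular h_{(i+j) mod m} is finite whenever h_i and h_j are both finite). -/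
open scoped Classical

/-- Let `G ⊊ ℕ`, `A = ℕ \ G`, `A \ {0}` nonempty, `m = min (A \ {0})`, and
for `0 ≤ i < m` let `h i ∈ ℕ∞` be the infimum of the positive elements of `A` congruent
to `i` modulo `m` (`∞` if there are none).  Then `A` is closed under addition iff
(1) every `x ∈ G` is strictly below every positive `a ∈ A` congruent to `x` mod `m`, and
(2) `h ((i+j) % m) ≤ h i + h j` in `ℕ∞` for all `i, j < m`. -/
theorem semigroup_iff_head_conditions
    (G : Set ℕ) (hG : G ≠ Set.univ) (A : Set ℕ) (hA : A = Gᶜ)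
    (hne : (A \ {0}).Nonempty) (m : ℕ) (hm : m = sInf (A \ {0}))
    (h : ℕ → ℕ∞)
    (hh : ∀ i : ℕ, h i = sInf ((Nat.cast : ℕ → ℕ∞) '' {a : ℕ | a ∈ A ∧ 0 < a ∧ a % m = i})) :
    (∀ a ∈ A, ∀ b ∈ A, a + b ∈ A) ↔
      ((∀ x ∈ G, ∀ a ∈ A, 0 < a → a % m = x % m → x < a) ∧
       (∀ i j : ℕ, i < m → j < m → h ((i + j) % m) ≤ h i + h j)) := by
  have hmA : m ∈ A \ {0} := hm ▸ Nat.sInf_mem hne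
  have hm0 : 0 < m := Nat.pos_of_ne_zero hmA.2
  have h_le : ∀ a ∈ A, 0 < a → h (a % m) ≤ a := fun a ha ha0 => by
    rw [hh]
    exact sInf_le ⟨a, ⟨ha, ha0, rfl⟩, rfl⟩
  have h_attained : ∀ i, h i ≠ ⊤ → ∃ a ∈ A, 0 < a ∧ a % m = i ∧ (a : ℕ∞) = h i := by
    intro i hi
    have hS : ((Nat.cast : ℕ → ℕ∞) '' {a : ℕ | a ∈ A ∧ 0 < a ∧ a % m = i}).Nonempty := by
      by_contra hS
      rw [Set.not_nonempty_iff_eq_empty] at hS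
      exact hi (by rw [hh, hS, sInf_empty])
    obtain ⟨a, ⟨ha, ha0, hai⟩, hah⟩ := csInf_mem hS
    exact ⟨a, ha, ha0, hai, by rw [hah, hh]⟩
  constructor
  · intro hadd
    have add_mul_mem : ∀ a ∈ A, ∀ k : ℕ, a + m * k ∈ A := by
      intro a ha k
      induction k with
      | zero => simpa using ha
      | succ k ih =>
        rw [mul_add_one, ← add_assoc]
        exact hadd _ ih m hmA.1
    refine ⟨fun x hx a ha _ hax => ?_, fun i j _ _ => ?_⟩
    · by_contra! hle
      obtain ⟨k, hk⟩ := (Nat.modEq_iff_dvd' hle).mp hax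
      have hxA := add_mul_mem a ha k
      rw [← hk, Nat.add_sub_cancel' hle, hA] at hxA
      exact hxA hx
    · by_cases hi : h i = ⊤
      · simp [hi]
      by_cases hj : h j = ⊤
      · simp [hj]
      obtain ⟨a, ha, ha0, rfl, hah⟩ := h_attained i hi
      obtain ⟨b, hb, -, rfl, hbh⟩ := h_attained j hj
      rw [← hah, ← hbh, ← Nat.add_mod, ← Nat.cast_add]
      exact h_le _ (hadd a ha b hb) (by omega)
  · rintro ⟨hbelow, hsub⟩ a ha b hb
    rcases Nat.eq_zero_or_pos a with rfl | ha0
    · simpa using hb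
    rcases Nat.eq_zero_or_pos b with rfl | hb0
    · simpa using ha
    by_contra hab
    have habG : a + b ∈ G := by
      rw [hA] at hab
      exact not_not.mp hab
    have hle : h ((a + b) % m) ≤ ((a + b : ℕ) : ℕ∞) := by
      rw [Nat.add_mod, Nat.cast_add]
      exact (hsub _ _ (Nat.mod_lt a hm0) (Nat.mod_lt b hm0)).trans
        (add_le_add (h_le a ha ha0) (h_le b hb hb0))
    obtain ⟨c, hc, hc0, hcm, hch⟩ :=
      h_attained _ (ne_top_of_le_ne_top (ENat.natCast_ne_top _) hle)
    rw [← hch, Nat.cast_le] at hle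
    exact (hbelow _ habG c hc hc0 hcm).not_ge hle
end

section
/- Let m ≥ 2 and let G be a gapset of multiplicity m and genus g. Then there exists x ∈ ℕ \ G such that G ∪ {x} is a gapset of multiplicity m and genus g + 1. -/
/-- A gapset: a finite subset of `ℕ` not containing `0` whose complement is closed under
addition. -/
def IsGapset (G : Finset ℕ) : Prop :=
  (0 : ℕ) ∉ G ∧ ∀ a b : ℕ, a ∉ G → b ∉ G → a + b ∉ G

/-- The multiplicity of a gapset: the least positive element of its complement. -/
noncomputable def gapsetMult (G : Finset ℕ) : ℕ :=
  sInf {x : ℕ | 0 < x ∧ x ∉ G}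

/-- `nmg m g` is the number of gapsets of multiplicity `m` and genus `g`. -/
noncomputable def nmg (m g : ℕ) : ℕ :=
  Nat.card {G : Finset ℕ // IsGapset G ∧ gapsetMult G = m ∧ G.card = g}

/-- For `m ≥ 2` there is a least natural number outside `G` that is not divisible by `m`. -/
theorem exists_least_notMem_not_dvd (G : Finset ℕ) (m : ℕ) (hm : 2 ≤ m) :
    ∃ x : ℕ, x ∉ G ∧ ¬ m ∣ x ∧ ∀ y < x, y ∉ G → m ∣ y := by
  classical
  have h : ∃ x : ℕ, x ∉ G ∧ ¬ m ∣ x := by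
    refine ⟨m * (G.sup id + 1) + 1, fun hx => ?_, fun hx => ?_⟩
    · have hle : m * (G.sup id + 1) + 1 ≤ G.sup id := Finset.le_sup (f := id) hx
      nlinarith
    · have := Nat.le_of_dvd one_pos ((Nat.dvd_add_right (dvd_mul_right m _)).mp hx)
      omega
  refine ⟨Nat.find h, (Nat.find_spec h).1, (Nat.find_spec h).2, fun y hy hyG => ?_⟩
  by_contra hdvd
  exact Nat.find_min h hy ⟨hyG, hdvd⟩

/-- Adding to a gapset a non-zero non-gap that is not a sum of two smaller non-gaps gives a
gapset. -/
theorem IsGapset.insert {G : Finset ℕ} (hG : IsGapset G) {x : ℕ} (hx : x ≠ 0)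
    (hsum : ∀ a b : ℕ, a < x → b < x → a ∉ G → b ∉ G → a + b ≠ x) :
    IsGapset (insert x G) := by
  refine ⟨by simp [hG.1, hx.symm], fun a b ha hb => ?_⟩
  rw [Finset.mem_insert, not_or] at ha hb ⊢
  refine ⟨fun h => ?_, hG.2 a b ha.2 hb.2⟩
  exact hsum a b (by omega) (by omega) ha.2 hb.2 h

/-- Adding an element other than the multiplicity does not change the multiplicity. -/
theorem gapsetMult_insert {G : Finset ℕ} {x : ℕ} (hpos : 0 < gapsetMult G)
    (hx : x ≠ gapsetMult G) : gapsetMult (insert x G) = gapsetMult G := by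
  have hmem : gapsetMult G ∈ {y : ℕ | 0 < y ∧ y ∉ G} :=
    Nat.sInf_mem (Nat.nonempty_of_pos_sInf hpos)
  have hmem' : gapsetMult G ∈ {y : ℕ | 0 < y ∧ y ∉ insert x G} :=
    ⟨hpos, by simpa [hx.symm] using hmem.2⟩
  refine le_antisymm (Nat.sInf_le hmem') ?_
  obtain ⟨h₀, h₁⟩ := Nat.sInf_mem ⟨_, hmem'⟩
  exact Nat.sInf_le ⟨h₀, fun h => h₁ (Finset.mem_insert_of_mem h)⟩

/-- Let `m ≥ 2` and let `G` be a gapset of multiplicity `m` and genus `g`.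
Then there exists `x ∉ G` such that `G ∪ {x}` is a gapset of multiplicity `m` and genus
`g + 1`. -/
theorem gapset_has_extension
    (m g : ℕ) (hm : 2 ≤ m)
    (G : Finset ℕ) (hG : IsGapset G) (hGm : gapsetMult G = m) (hGg : G.card = g) :
    ∃ x : ℕ, x ∉ G ∧ IsGapset (insert x G) ∧ gapsetMult (insert x G) = m ∧
      (insert x G).card = g + 1 := by
  obtain ⟨x, hxG, hdvd, hmin⟩ := exists_least_notMem_not_dvd G m hm
  refine ⟨x, hxG, hG.insert ?_ ?_, ?_, by rw [Finset.card_insert_of_notMem hxG, hGg]⟩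
  · rintro rfl
    exact hdvd (dvd_zero m)
  · rintro a b ha hb haG hbG rfl
    exact hdvd (dvd_add (hmin a ha haG) (hmin b hb hbG))
  · rw [gapsetMult_insert (by omega), hGm]
    rintro rfl
    exact hdvd (by rw [hGm])
end

section
/- Let m ≥ 2 and let G be a gapset of multiplicity m and genus g with g ≥ m. Then there exists x ∈ G such that G \ {x} is a gapset of multiplicity m and genus g − 1. -/
theorem IsGapset.erase_max' {G : Finset ℕ} (hG : IsGapset G) (hne : G.Nonempty) :
    IsGapset (G.erase (G.max' hne)) := by
  refine ⟨fun h => hG.1 (Finset.mem_of_mem_erase h), fun a b ha hb hab => ?_⟩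
  obtain ⟨hab_ne, hab_mem⟩ := Finset.mem_erase.mp hab
  have hle := G.le_max' _ hab_mem
  refine hG.2 a b (fun h => ha ?_) (fun h => hb ?_) hab_mem
  · exact Finset.mem_erase.mpr ⟨by omega, h⟩
  · exact Finset.mem_erase.mpr ⟨by omega, h⟩

theorem gapsetMult_mem {G : Finset ℕ} (h : 0 < gapsetMult G) : gapsetMult G ∉ G :=
  (Nat.sInf_mem (Nat.nonempty_of_pos_sInf h)).2

theorem gapsetMult_erase_of_lt {G : Finset ℕ} {x : ℕ} (h : 0 < gapsetMult G)
    (hx : gapsetMult G < x) : gapsetMult (G.erase x) = gapsetMult G := by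
  refine IsLeast.csInf_eq ⟨⟨h, fun hmem => gapsetMult_mem h (Finset.mem_of_mem_erase hmem)⟩, ?_⟩
  rintro y ⟨hy, hyG⟩
  by_cases hyx : y = x
  · exact hyx ▸ hx.le
  · exact Nat.sInf_le ⟨hy, fun hmem => hyG (Finset.mem_erase.mpr ⟨hyx, hmem⟩)⟩

theorem IsGapset.exists_gapsetMult_lt {G : Finset ℕ} (hG : IsGapset G) (h : 0 < gapsetMult G)
    (hcard : gapsetMult G ≤ G.card) : ∃ y ∈ G, gapsetMult G < y := by
  by_contra! hle
  have hsub : G ⊆ Finset.Ioo 0 (gapsetMult G) := fun y hy =>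
    Finset.mem_Ioo.mpr ⟨Nat.pos_of_ne_zero fun h0 => hG.1 (h0 ▸ hy),
      lt_of_le_of_ne (hle y hy) fun heq => gapsetMult_mem h (heq ▸ hy)⟩
  have := Finset.card_le_card hsub
  rw [Nat.card_Ioo] at this
  omega

/-- Let `m ≥ 2` and let `G` be a gapset of multiplicity `m` and genus `g`
with `g ≥ m`.  Then there exists `x ∈ G` such that `G \ {x}` is a gapset of multiplicity
`m` and genus `g - 1`. -/
theorem gapset_has_reduction
    (m g : ℕ) (hm : 2 ≤ m) (hgm : m ≤ g)
    (G : Finset ℕ) (hG : IsGapset G) (hGm : gapsetMult G = m) (hGg : G.card = g) :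
    ∃ x ∈ G, IsGapset (G.erase x) ∧ gapsetMult (G.erase x) = m ∧
      (G.erase x).card = g - 1 := by
  subst hGm hGg
  have hpos : 0 < gapsetMult G := by omega
  obtain ⟨y, hy, hlt⟩ := hG.exists_gapsetMult_lt hpos hgm
  have hmax := G.max'_mem ⟨y, hy⟩
  exact ⟨_, hmax, hG.erase_max' _,
    gapsetMult_erase_of_lt hpos (hlt.trans_le (G.le_max' y hy)), Finset.card_erase_of_mem hmax⟩
end

section
/- Let m ≥ 2 and g ≥ m. If n_{m,g} ≥ n_{m,g−1}, then n_{m,g} ≥ m − 1. -/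
theorem IsGapset.subset_range {G : Finset ℕ} (hG : IsGapset G) :
    G ⊆ Finset.range (2 * G.card) := by
  intro F hF
  have hcover : Finset.range (F + 1) ⊆ G ∪ G.image (fun x => F - x) := by
    intro a ha
    rw [Finset.mem_range] at ha
    rw [Finset.mem_union, Finset.mem_image]
    by_contra! hcon
    obtain ⟨haG, himage⟩ := hcon
    have hFa : F - a ∉ G := fun hmem => himage (F - a) hmem (by omega)
    have hsum := hG.2 a (F - a) haG hFa
    rw [show a + (F - a) = F by omega] at hsum
    exact hsum hF
  have hcard := (Finset.card_le_card hcover).trans (Finset.card_union_le _ _)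
  have himage : (G.image (fun x => F - x)).card ≤ G.card := Finset.card_image_le
  rw [Finset.card_range] at hcard
  rw [Finset.mem_range]
  omega

instance finite_gapsets (m g : ℕ) :
    Finite {G : Finset ℕ // IsGapset G ∧ gapsetMult G = m ∧ G.card = g} := by
  refine Set.Finite.to_subtype
    (s := {G : Finset ℕ | IsGapset G ∧ gapsetMult G = m ∧ G.card = g}) ?_
  refine (Finset.finite_toSet (Finset.range (2 * g)).powerset).subset ?_
  rintro G ⟨hG, -, rfl⟩
  exact Finset.mem_coe.2 (Finset.mem_powerset.2 hG.subset_range)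

/-- The set of naturals whose quotient by `m` is below the Kunz coordinate of their residue. -/
def kunzSet (m : ℕ) (k : ℕ → ℕ) : Finset ℕ :=
  ((Finset.range m).sigma fun i => Finset.range (k i)).image fun p => m * p.2 + p.1

theorem mem_kunzSet {m : ℕ} (hm : 0 < m) {k : ℕ → ℕ} {x : ℕ} :
    x ∈ kunzSet m k ↔ x / m < k (x % m) := by
  simp only [kunzSet, Finset.mem_image, Finset.mem_sigma, Finset.mem_range]
  constructor
  · rintro ⟨⟨i, t⟩, ⟨hi, ht⟩, rfl⟩
    rwa [Nat.mul_add_div hm, Nat.mul_add_mod, Nat.div_eq_of_lt hi, Nat.mod_eq_of_lt hi]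
  · intro hx
    exact ⟨⟨x % m, x / m⟩, ⟨Nat.mod_lt x hm, hx⟩, Nat.div_add_mod x m⟩

theorem card_kunzSet {m : ℕ} (hm : 0 < m) (k : ℕ → ℕ) :
    (kunzSet m k).card = ∑ i ∈ Finset.range m, k i := by
  rw [kunzSet, Finset.card_image_of_injOn, Finset.card_sigma]
  · simp
  · rintro ⟨i, t⟩ hp ⟨j, u⟩ hq heq
    simp only [Finset.coe_sigma, Set.mem_sigma_iff, Finset.coe_range, Set.mem_Iio] at hp hq heq
    have hmod := congrArg (· % m) heq
    have hdiv := congrArg (· / m) heq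
    simp only [Nat.mul_add_mod, Nat.mod_eq_of_lt hp.1, Nat.mod_eq_of_lt hq.1] at hmod
    simp only [Nat.mul_add_div hm, Nat.div_eq_of_lt hp.1, Nat.div_eq_of_lt hq.1,
      add_zero] at hdiv
    subst hmod hdiv
    rfl

theorem isGapset_kunzSet {m : ℕ} (hm : 0 < m) {k : ℕ → ℕ} (hzero : k 0 = 0)
    (hkunz : ∀ i < m, ∀ j < m, k ((i + j) % m) ≤ k i + k j + (i + j) / m) :
    IsGapset (kunzSet m k) := by
  refine ⟨by simp [mem_kunzSet hm, hzero], fun a b ha hb => ?_⟩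
  rw [mem_kunzSet hm, not_lt] at ha hb ⊢
  have hsum := hkunz _ (Nat.mod_lt a hm) _ (Nat.mod_lt b hm)
  rw [← Nat.add_mod] at hsum
  have hdiv : (a + b) / m = a / m + b / m + (a % m + b % m) / m := by
    conv_lhs => rw [← Nat.div_add_mod a m, ← Nat.div_add_mod b m]
    rw [show m * (a / m) + a % m + (m * (b / m) + b % m) =
      m * (a / m + b / m) + (a % m + b % m) by ring, Nat.mul_add_div hm]
  omega

theorem gapsetMult_kunzSet {m : ℕ} (hm : 0 < m) {k : ℕ → ℕ} (hzero : k 0 = 0)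
    (hpos : ∀ i < m, 0 < i → 0 < k i) : gapsetMult (kunzSet m k) = m := by
  have hmem : m ∈ {x : ℕ | 0 < x ∧ x ∉ kunzSet m k} :=
    ⟨hm, by simp [mem_kunzSet hm, hzero]⟩
  refine le_antisymm (Nat.sInf_le hmem) (le_csInf ⟨m, hmem⟩ ?_)
  rintro x ⟨hx, hxk⟩
  by_contra! hlt
  rw [mem_kunzSet hm, Nat.div_eq_of_lt hlt, Nat.mod_eq_of_lt hlt] at hxk
  exact hxk (hpos x hlt hx)

theorem eq_of_kunzSet_eq {m : ℕ} (hm : 0 < m) {k l : ℕ → ℕ} (h : kunzSet m k = kunzSet m l)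
    {i : ℕ} (hi : i < m) : k i = l i := by
  have hlt (t : ℕ) : t < k i ↔ t < l i := by
    have := congrArg (m * t + i ∈ ·) h
    simpa [mem_kunzSet hm, Nat.mul_add_div hm, Nat.mul_add_mod, Nat.div_eq_of_lt hi,
      Nat.mod_eq_of_lt hi] using this
  have h1 := hlt (k i)
  have h2 := hlt (l i)
  omega

/-- A family of distinct Kunz coordinate vectors bounds the number of gapsets from below. -/
theorem card_le_nmg {ι : Type*} {m g : ℕ} (hm : 0 < m) (k : ι → ℕ → ℕ)
    (hzero : ∀ a, k a 0 = 0) (hpos : ∀ a, ∀ i < m, 0 < i → 0 < k a i)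
    (hkunz : ∀ a, ∀ i < m, ∀ j < m, k a ((i + j) % m) ≤ k a i + k a j + (i + j) / m)
    (hsum : ∀ a, ∑ i ∈ Finset.range m, k a i = g)
    (hinj : ∀ a b, (∀ i < m, k a i = k b i) → a = b) :
    Nat.card ι ≤ nmg m g := by
  refine Nat.card_le_card_of_injective
    (fun a => ⟨kunzSet m (k a), isGapset_kunzSet hm (hzero a) (hkunz a),
      gapsetMult_kunzSet hm (hzero a) (hpos a), (card_kunzSet hm _).trans (hsum a)⟩) ?_
  intro a b hab
  exact hinj a b fun i hi => eq_of_kunzSet_eq hm (congrArg Subtype.val hab) hi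

theorem sum_range_ite_zero {m : ℕ} (hm : 0 < m) (f : ℕ → ℕ) :
    ∑ i ∈ Finset.range m, (if i = 0 then 0 else f i) = ∑ i ∈ Finset.Ico 1 m, f i := by
  rw [Finset.range_eq_Ico, Finset.sum_eq_sum_Ico_succ_bot hm]
  simp only [↓reduceIte, zero_add]
  refine Finset.sum_congr rfl fun i hi => if_neg ?_
  have := (Finset.mem_Ico.1 hi).1
  omega

theorem choose_le_nmg {m q r : ℕ} (hm : 0 < m) (hq : 0 < q) :
    (m - 1).choose r ≤ nmg m ((m - 1) * q + r) := by
  have hcard : Nat.card {s // s ∈ (Finset.Ico 1 m).powersetCard r} = (m - 1).choose r := by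
    rw [Nat.card_eq_fintype_card, Fintype.card_coe, Finset.card_powersetCard, Nat.card_Ico]
  rw [← hcard]
  refine card_le_nmg hm
    (fun s i => if i = 0 then 0 else q + if i ∈ s.1 then 1 else 0) ?_ ?_ ?_ ?_ ?_
  · simp
  · intro s i _ hi
    simp only [hi.ne', if_false]
    omega
  · intro s i hi j hj
    by_cases hi0 : i = 0
    · simp [hi0, Nat.mod_eq_of_lt hj]
    by_cases hj0 : j = 0
    · simp [hj0, Nat.mod_eq_of_lt hi]
    simp only [hi0, hj0, if_false]
    generalize (i + j) / m = c
    split_ifs <;> omega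
  · rintro ⟨s, hs⟩
    rw [Finset.mem_powersetCard] at hs
    rw [sum_range_ite_zero hm, Finset.sum_add_distrib, ← Finset.card_filter,
      Finset.filter_mem_eq_inter, Finset.inter_eq_right.2 hs.1, hs.2]
    simp
  · rintro ⟨s, hs⟩ ⟨t, ht⟩ hst
    rw [Finset.mem_powersetCard] at hs ht
    refine Subtype.ext (Finset.ext fun i => ?_)
    by_cases hi : i ∈ Finset.Ico 1 m
    · rw [Finset.mem_Ico] at hi
      have := hst i hi.2
      simp only [show i ≠ 0 by omega, if_false] at this
      by_cases h1 : i ∈ s <;> by_cases h2 : i ∈ t <;> simp_all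
    · exact ⟨fun h => absurd (hs.1 h) hi, fun h => absurd (ht.1 h) hi⟩

theorem sub_one_le_nmg_mul {m q : ℕ} (hm : 2 ≤ m) (hq : 2 ≤ q) :
    m - 1 ≤ nmg m ((m - 1) * q) := by
  have hcard : Nat.card {j // j ∈ Finset.Ico 1 m} = m - 1 := by
    rw [Nat.card_eq_fintype_card, Fintype.card_coe, Nat.card_Ico]
  conv_lhs => rw [← hcard]
  refine card_le_nmg (by omega)
    (fun j i => if i = 0 then 0 else
      q + (if i = j.1 then 1 else 0) - (if i = m - 1 then 1 else 0)) ?_ ?_ ?_ ?_ ?_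
  · simp
  · intro j i _ hi
    simp only [hi.ne', if_false]
    split_ifs <;> omega
  · rintro ⟨a, ha⟩ i hi j hj
    rw [Finset.mem_Ico] at ha
    by_cases hi0 : i = 0
    · simp [hi0, Nat.mod_eq_of_lt hj]
    by_cases hj0 : j = 0
    · simp [hj0, Nat.mod_eq_of_lt hi]
    rcases lt_or_ge (i + j) m with hij | hij
    · rw [Nat.mod_eq_of_lt hij, Nat.div_eq_of_lt hij]
      simp only [hi0, hj0, if_false]
      split_ifs <;> omega
    · rw [Nat.mod_eq_sub_mod hij, Nat.mod_eq_of_lt (by omega : i + j - m < m),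
        show (i + j) / m = 1 from Nat.div_eq_of_lt_le (by omega) (by omega)]
      simp only [hi0, hj0, if_false]
      split_ifs <;> omega
  · rintro ⟨a, ha⟩
    rw [sum_range_ite_zero (by omega)]
    have hlast : m - 1 ∈ Finset.Ico 1 m := Finset.mem_Ico.2 (by omega)
    have hsum : ∑ i ∈ Finset.Ico 1 m,
        ((q + (if i = a then 1 else 0) - (if i = m - 1 then 1 else 0)) +
          (if i = m - 1 then 1 else 0)) =
        ∑ i ∈ Finset.Ico 1 m, (q + (if i = a then 1 else 0)) :=
      Finset.sum_congr rfl fun i _ => by split_ifs <;> omega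
    rw [Finset.sum_add_distrib, Finset.sum_add_distrib, Finset.sum_ite_eq' _ (m - 1),
      Finset.sum_ite_eq' _ a, if_pos ha, if_pos hlast] at hsum
    simpa using hsum
  · rintro ⟨a, ha⟩ ⟨b, hb⟩ hab
    rw [Finset.mem_Ico] at ha hb
    have := hab a ha.2
    simp only [show a ≠ 0 by omega, if_false, if_true] at this
    refine Subtype.ext ?_
    by_contra hne
    simp only at hne
    rw [if_neg hne] at this
    split_ifs at this <;> omega

theorem le_choose_of_pos_of_lt {n r : ℕ} (hr : 0 < r) (hrn : r < n) : n ≤ n.choose r := by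
  induction n with
  | zero => omega
  | succ n ih =>
    obtain ⟨r, rfl⟩ := Nat.exists_eq_add_one.2 hr
    rw [Nat.choose_succ_succ']
    rcases Nat.lt_or_ge (r + 1) n with hlt | hge
    · have := ih hlt
      have := Nat.choose_pos (show r ≤ n by omega)
      omega
    · obtain rfl : n = r + 1 := by omega
      simp

/-- Every genus `g ≥ m` has at least `m - 1` gapsets of multiplicity `m`. -/
theorem sub_one_le_nmg {m g : ℕ} (hm : 2 ≤ m) (hg : m ≤ g) : m - 1 ≤ nmg m g := by
  have hdiv := Nat.div_add_mod g (m - 1)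
  have hmod := Nat.mod_lt g (show m - 1 > 0 by omega)
  have hq : 0 < g / (m - 1) := Nat.div_pos (by omega) (by omega)
  rcases Nat.eq_zero_or_pos (g % (m - 1)) with hr | hr
  · have hq2 : 2 ≤ g / (m - 1) := by
      by_contra! hlt
      rw [hr, show g / (m - 1) = 1 by omega] at hdiv
      omega
    have := sub_one_le_nmg_mul hm hq2
    rwa [show (m - 1) * (g / (m - 1)) = g by omega] at this
  · have := choose_le_nmg (m := m) (r := g % (m - 1)) (by omega) hq
    rw [hdiv] at this
    exact (le_choose_of_pos_of_lt hr hmod).trans this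

/-- Let `m ≥ 2` and `g ≥ m`.  If `nmg m g ≥ nmg m (g-1)` then
`nmg m g ≥ m - 1`. -/
theorem nmg_ge_m_sub_one_of_mono
    (m g : ℕ) (hm : 2 ≤ m) (hg : m ≤ g)
    (h : nmg m (g - 1) ≤ nmg m g) :
    m - 1 ≤ nmg m g := by
  exact sub_one_le_nmg hm hg
end

section
/- For every m ≥ 4, the number of gapsets of multiplicity m and genus m + 1 satisfies n_{m,m+1} ≥ m. -/
/-- Every element of a gapset is less than twice the genus. -/
theorem IsGapset.lt_two_mul_card {G : Finset ℕ} (hG : IsGapset G) {x : ℕ} (hx : x ∈ G) :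
    x < 2 * G.card := by
  have hsub : Finset.range (x + 1) ⊆ G ∪ G.image (fun a => x - a) := by
    intro a ha
    have hax : a ≤ x := by simpa [Nat.lt_succ_iff] using ha
    by_contra h
    simp only [Finset.mem_union, Finset.mem_image, not_or, not_exists, not_and] at h
    have hxa : x - a ∉ G := fun hmem => h.2 _ hmem (by omega)
    have hsum := hG.2 a (x - a) h.1 hxa
    rw [Nat.add_sub_cancel' hax] at hsum
    exact hsum hx
  have hcard := (Finset.card_le_card hsub).trans (Finset.card_union_le _ _)
  have himage : (G.image (fun a => x - a)).card ≤ G.card := Finset.card_image_le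
  rw [Finset.card_range] at hcard
  omega

theorem finite_setOf_isGapset (m g : ℕ) :
    {G : Finset ℕ | IsGapset G ∧ gapsetMult G = m ∧ G.card = g}.Finite := by
  refine (Finset.finite_toSet (Finset.range (2 * g)).powerset).subset ?_
  rintro G ⟨hG, -, rfl⟩
  simp only [Finset.coe_powerset, Set.mem_preimage, Set.mem_powerset_iff, Finset.coe_subset]
  exact fun x hx => Finset.mem_range.2 (hG.lt_two_mul_card hx)

/-- The interval `[1, m)` together with the two elements `a` and `b`. -/
def intervalWithPair (m a b : ℕ) : Finset ℕ :=
  Finset.Ico 1 m ∪ {a, b}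

theorem mem_intervalWithPair {m a b x : ℕ} :
    x ∈ intervalWithPair m a b ↔ (1 ≤ x ∧ x < m) ∨ x = a ∨ x = b := by
  simp only [intervalWithPair, Finset.mem_union, Finset.mem_Ico, Finset.mem_insert,
    Finset.mem_singleton]

theorem gapsetMult_intervalWithPair {m a b : ℕ} (hm : 0 < m) (ha : m < a) (hb : m < b) :
    gapsetMult (intervalWithPair m a b) = m := by
  refine IsLeast.csInf_eq ⟨⟨hm, ?_⟩, ?_⟩
  · rw [mem_intervalWithPair]
    omega
  · rintro x ⟨hx, hxG⟩
    rw [mem_intervalWithPair] at hxG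
    omega

theorem card_intervalWithPair {m a b : ℕ} (hm : 0 < m) (ha : m < a) (hab : a < b) :
    (intervalWithPair m a b).card = m + 1 := by
  rw [intervalWithPair, Finset.card_union_of_disjoint, Nat.card_Ico,
    Finset.card_pair hab.ne]
  · omega
  · rw [Finset.disjoint_left]
    intro x hx
    simp only [Finset.mem_Ico, Finset.mem_insert, Finset.mem_singleton] at hx ⊢
    omega

theorem isGapset_intervalWithPair {m a b : ℕ} (hm : 2 ≤ m) (ha : m < a) (hab : a < b)
    (hb : b < 2 * m ∨ a = m + 1 ∧ b = 2 * m + 1) :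
    IsGapset (intervalWithPair m a b) := by
  refine ⟨?_, fun x y hx hy => ?_⟩
  · rw [mem_intervalWithPair]
    omega
  · simp only [mem_intervalWithPair] at hx hy ⊢
    omega

theorem intervalWithPair_injOn {m a : ℕ} :
    Set.InjOn (intervalWithPair m a) {b | m < b ∧ a < b} := by
  intro b hb c _ h
  obtain ⟨hmb, hab⟩ : m < b ∧ a < b := hb
  have hmem : b ∈ intervalWithPair m a c := h ▸ mem_intervalWithPair.2 (Or.inr (Or.inr rfl))
  rw [mem_intervalWithPair] at hmem
  omega

/-- For every `m ≥ 4`, the number of gapsets of multiplicity `m` and genus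
`m + 1` satisfies `nmg m (m+1) ≥ m`. -/
theorem nmg_m_succ_ge_m
    (m : ℕ) (hm : 4 ≤ m) :
    m ≤ nmg m (m + 1) := by
  set B : Finset ℕ := insert (2 * m + 1) (Finset.Ico (m + 2) (2 * m)) with hB
  have hBmem : ∀ b ∈ B, b = 2 * m + 1 ∨ (m + 2 ≤ b ∧ b < 2 * m) := by
    intro b hb
    simpa [hB] using hb
  have hBcard : B.card = m - 1 := by
    rw [hB, Finset.card_insert_of_notMem (by simp), Nat.card_Ico]
    omega
  set F : Finset (Finset ℕ) :=
    insert (intervalWithPair m (m + 2) (m + 3)) (B.image (intervalWithPair m (m + 1))) with hF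
  have hFcard : F.card = m := by
    rw [hF, Finset.card_insert_of_notMem, Finset.card_image_of_injOn, hBcard]
    · omega
    · refine intervalWithPair_injOn.mono fun b hb => ?_
      have := hBmem b hb
      constructor <;> omega
    · intro h
      obtain ⟨b, -, h⟩ := Finset.mem_image.1 h
      have hmem : m + 1 ∈ intervalWithPair m (m + 2) (m + 3) :=
        h ▸ mem_intervalWithPair.2 (Or.inr (Or.inl rfl))
      rw [mem_intervalWithPair] at hmem
      omega
  have hsub : (F : Set (Finset ℕ)) ⊆
      {G : Finset ℕ | IsGapset G ∧ gapsetMult G = m ∧ G.card = m + 1} := by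
    intro G hG
    rw [hF, Finset.mem_coe, Finset.mem_insert, Finset.mem_image] at hG
    rcases hG with rfl | ⟨b, hb, rfl⟩
    · exact ⟨isGapset_intervalWithPair (by omega) (by omega) (by omega) (by omega),
        gapsetMult_intervalWithPair (by omega) (by omega) (by omega),
        card_intervalWithPair (by omega) (by omega) (by omega)⟩
    · have := hBmem b hb
      exact ⟨isGapset_intervalWithPair (by omega) (by omega) (by omega) (by omega),
        gapsetMult_intervalWithPair (by omega) (by omega) (by omega),
        card_intervalWithPair (by omega) (by omega) (by omega)⟩
  have hle := Set.ncard_le_ncard hsub (finite_setOf_isGapset m (m + 1))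
  rw [Set.ncard_coe_finset, hFcard] at hle
  exact hle
end
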